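/- arXiv:1712.01418 — 2 statements merged into one kernel-verified Lean document; each statement's English description precedes it below -/
import Mathlib

section
/- Define a_n = pav_r(2n) = c(2n)/(2n−1)!, where c(m) is the number of transitive triples of fixed-point-free involutions on Fin m. Then a_1 = 1 and for all n ≥ 2, a_n = 2n · a_{n−1} + Σ_{k=1}^{n−2} a_k · a_{n−1−k}. -/
/-- A fixed-point-free involution: a permutation `σ` with `σ ∘ σ = id` and no
fixed point. -/
def IsFPFInvolution {D : Type*} (σ : Equiv.Perm D) : Prop :=
  σ * σ = 1 ∧ ∀ x, σ x ≠ x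

/-- A transitive triple on `Fin m`: a triple of fixed-point-free involutions
generating a subgroup that acts transitively on `Fin m`. -/
def IsTransitiveTriple {m : ℕ}
    (t : Equiv.Perm (Fin m) × Equiv.Perm (Fin m) × Equiv.Perm (Fin m)) : Prop :=
  (IsFPFInvolution t.1 ∧ IsFPFInvolution t.2.1 ∧ IsFPFInvolution t.2.2) ∧
    ∀ x y : Fin m, ∃ g ∈ Subgroup.closure ({t.1, t.2.1, t.2.2} :
      Set (Equiv.Perm (Fin m))), g x = y

/-- `c(m)`: the number of transitive triples on `Fin m`. -/
noncomputable def cTrans (m : ℕ) : ℕ :=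
  Nat.card {t : Equiv.Perm (Fin m) × Equiv.Perm (Fin m) × Equiv.Perm (Fin m) //
    IsTransitiveTriple t}

/-- `a n = pav_r(2n) = c(2n)/(2n-1)!`, the number of rooted connected pavings
on `2n` darts. -/
noncomputable def a (n : ℕ) : ℚ :=
  (cTrans (2 * n) : ℚ) / (Nat.factorial (2 * n - 1) : ℚ)

/-- The type of fixed-point-free involutions of `D`. -/
abbrev FPF (D : Type*) := {σ : Equiv.Perm D // IsFPFInvolution σ}

lemma FPF.apply_apply {D : Type*} (σ : FPF D) (x : D) : σ.1 (σ.1 x) = x := by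
  rw [← Equiv.Perm.mul_apply, σ.2.1, Equiv.Perm.one_apply]

/-- `S` is stable under every member of the family `τ`. -/
def IsStable {D ι : Type*} (τ : ι → FPF D) (S : Set D) : Prop :=
  ∀ i, ∀ x ∈ S, (τ i).1 x ∈ S

lemma IsStable.compl {D ι : Type*} {τ : ι → FPF D} {S : Set D} (h : IsStable τ S) :
    IsStable τ Sᶜ := fun i x hx hx' => hx (by simpa [FPF.apply_apply] using h i _ hx')

/-- The family `τ` has no nontrivial stable subset. -/
def IsConn {D ι : Type*} (τ : ι → FPF D) : Prop :=
  ∀ S : Set D, S.Nonempty → IsStable τ S → S = Set.univ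

/-- The least stable set containing `d`. -/
def component {D ι : Type*} (τ : ι → FPF D) (d : D) : Set D :=
  ⋂₀ {S | IsStable τ S ∧ d ∈ S}

lemma mem_component {D ι : Type*} (τ : ι → FPF D) (d : D) : d ∈ component τ d :=
  Set.mem_sInter.2 fun _ hS => hS.2

lemma isStable_component {D ι : Type*} (τ : ι → FPF D) (d : D) :
    IsStable τ (component τ d) := fun i x hx =>
  Set.mem_sInter.2 fun S hS => hS.1 i x (Set.mem_sInter.1 hx S hS)

lemma component_subset {D ι : Type*} {τ : ι → FPF D} {d : D} {S : Set D} (hS : IsStable τ S)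
    (hd : d ∈ S) : component τ d ⊆ S := Set.sInter_subset_of_mem ⟨hS, hd⟩

/-- Restrict a fixed-point-free involution to a stable subtype. -/
def FPF.restrict {D : Type*} {p : D → Prop} (σ : FPF D) (h : ∀ x, p (σ.1 x) ↔ p x) :
    FPF {x // p x} :=
  ⟨σ.1.subtypePerm h, by
    constructor
    · ext x
      exact σ.apply_apply x
    · intro x hx
      exact σ.2.2 x (congrArg Subtype.val hx)⟩

section Glue

variable {D ι : Type*} {p : D → Prop} [DecidablePred p]

/-- Glue fixed-point-free involutions of a subtype and of its complement. -/
def FPF.glue (u : FPF {x // p x}) (v : FPF {x // ¬ p x}) : FPF D :=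
  ⟨u.1.subtypeCongr v.1, by
    constructor
    · ext x
      by_cases h : p x
      · have h2 := (u.1 ⟨x, h⟩).2
        rw [Equiv.Perm.mul_apply, Equiv.Perm.subtypeCongr.left_apply _ _ h,
          Equiv.Perm.subtypeCongr.left_apply_subtype, u.apply_apply]
        rfl
      · rw [Equiv.Perm.mul_apply, Equiv.Perm.subtypeCongr.right_apply _ _ h,
          Equiv.Perm.subtypeCongr.right_apply_subtype, v.apply_apply]
        rfl
    · intro x hx
      by_cases h : p x
      · rw [Equiv.Perm.subtypeCongr.left_apply _ _ h] at hx
        exact u.2.2 ⟨x, h⟩ (Subtype.ext hx)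
      · rw [Equiv.Perm.subtypeCongr.right_apply _ _ h] at hx
        exact v.2.2 ⟨x, h⟩ (Subtype.ext hx)⟩

lemma FPF.glue_left (u : FPF {x // p x}) (v : FPF {x // ¬ p x}) (x : {x // p x}) :
    (u.glue v).1 x = u.1 x := Equiv.Perm.subtypeCongr.left_apply_subtype _ _ x

lemma FPF.glue_right (u : FPF {x // p x}) (v : FPF {x // ¬ p x}) (x : {x // ¬ p x}) :
    (u.glue v).1 x = v.1 x := Equiv.Perm.subtypeCongr.right_apply_subtype _ _ x

lemma FPF.glue_injective {u u' : FPF {x // p x}} {v v' : FPF {x // ¬ p x}}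
    (h : u.glue v = u'.glue v') : u = u' ∧ v = v' := by
  constructor
  · ext x
    rw [← u.glue_left v, h, FPF.glue_left]
  · ext x
    rw [← u.glue_right v, h, FPF.glue_right]

lemma FPF.exists_glue (σ : FPF D) (h : ∀ x, p x → p (σ.1 x)) :
    ∃ u : FPF {x // p x}, ∃ v : FPF {x // ¬ p x}, u.glue v = σ := by
  have h' : ∀ x, p (σ.1 x) ↔ p x :=
    fun x => ⟨fun hx => by simpa [FPF.apply_apply] using h _ hx, h x⟩
  refine ⟨σ.restrict h', σ.restrict fun x => not_congr (h' x), ?_⟩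
  ext x
  by_cases hx : p x
  · exact FPF.glue_left _ _ ⟨x, hx⟩
  · exact FPF.glue_right _ _ ⟨x, hx⟩

lemma isStable_glue (u : ι → FPF {x // p x}) (v : ι → FPF {x // ¬ p x}) :
    IsStable (fun i => (u i).glue (v i)) {x | p x} := by
  intro i x hx
  have := ((u i).1 ⟨x, hx⟩).2
  rwa [← FPF.glue_left (u i) (v i)] at this

lemma IsStable.preimage_glue {u : ι → FPF {x // p x}} {v : ι → FPF {x // ¬ p x}} {S : Set D}
    (hS : IsStable (fun i => (u i).glue (v i)) S) :
    IsStable u (Subtype.val ⁻¹' S) := by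
  intro i x hx
  have := hS i x hx
  rwa [FPF.glue_left] at this

lemma IsStable.image_glue {u : ι → FPF {x // p x}} (v : ι → FPF {x // ¬ p x})
    {S : Set {x // p x}} (hS : IsStable u S) :
    IsStable (fun i => (u i).glue (v i)) (Subtype.val '' S) := by
  rintro i _ ⟨x, hx, rfl⟩
  exact ⟨_, hS i x hx, (FPF.glue_left _ _ _).symm⟩

lemma component_glue_eq_iff (u : ι → FPF {x // p x}) (v : ι → FPF {x // ¬ p x}) {d : D}
    (hd : p d) : component (fun i => (u i).glue (v i)) d = {x | p x} ↔ IsConn u := by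
  constructor
  · intro h S hS hst
    by_cases hdS : (⟨d, hd⟩ : {x // p x}) ∈ S
    · have := component_subset (hst.image_glue v) ⟨_, hdS, rfl⟩
      rw [h] at this
      refine Set.eq_univ_of_forall fun x => ?_
      obtain ⟨y, hy, hyx⟩ := this x.2
      rwa [← Subtype.ext hyx]
    · have := component_subset (hst.compl.image_glue v) ⟨_, hdS, rfl⟩
      rw [h] at this
      obtain ⟨x, hx⟩ := hS
      obtain ⟨y, hy, hyx⟩ := this x.2
      rw [Subtype.ext hyx] at hy
      exact absurd hx hy
  · intro h
    refine (component_subset (isStable_glue u v) hd).antisymm fun x hx => ?_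
    have := h (Subtype.val ⁻¹' component (fun i => (u i).glue (v i)) d)
      ⟨⟨d, hd⟩, mem_component _ d⟩ (isStable_component _ d).preimage_glue
    exact this.ge (Set.mem_univ (⟨x, hx⟩ : {x // p x}))

lemma card_component_eq (ι : Type*) {d : D} (hd : p d) :
    Nat.card {τ : ι → FPF D // component τ d = {x | p x}} =
      Nat.card {u : ι → FPF {x // p x} // IsConn u} * Nat.card (ι → FPF {x // ¬ p x}) := by
  rw [← Nat.card_prod]
  symm
  refine Nat.card_congr (Equiv.ofBijective
    (fun w => ⟨fun i => (w.1.1 i).glue (w.2 i), (component_glue_eq_iff _ _ hd).2 w.1.2⟩) ⟨?_, ?_⟩)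
  · rintro ⟨⟨u, hu⟩, v⟩ ⟨⟨u', hu'⟩, v'⟩ h
    have h1 := fun i => FPF.glue_injective (congrFun (congrArg Subtype.val h) i)
    have h2 : u = u' := funext fun i => (h1 i).1
    have h3 : v = v' := funext fun i => (h1 i).2
    subst h2 h3
    rfl
  · rintro ⟨τ, hτ⟩
    have hst := isStable_component τ d
    rw [hτ] at hst
    choose u v huv using fun i => (τ i).exists_glue (hst i)
    obtain rfl : (fun i => (u i).glue (v i)) = τ := funext huv
    exact ⟨(⟨u, (component_glue_eq_iff u v hd).1 hτ⟩, v), rfl⟩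

end Glue

/-- Transport fixed-point-free involutions along an equivalence. -/
def FPF.congr {D E : Type*} (e : D ≃ E) : FPF D ≃ FPF E :=
  e.permCongr.subtypeEquiv fun σ => by
    unfold IsFPFInvolution
    refine and_congr ?_ ?_
    · simp only [Equiv.ext_iff]
      simp [e.forall_congr_left, ← e.eq_symm_apply]
    · simp [e.forall_congr_left, ← e.eq_symm_apply]

lemma FPF.congr_apply {D E : Type*} (e : D ≃ E) (σ : FPF D) (x : D) :
    (FPF.congr e σ).1 (e x) = e (σ.1 x) := by
  simp [FPF.congr]

lemma IsConn.congr {D E ι : Type*} (e : D ≃ E) {τ : ι → FPF D} (h : IsConn τ) :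
    IsConn fun i => FPF.congr e (τ i) := by
  intro S hS hst
  have h1 : e ⁻¹' S = Set.univ := by
    refine h _ (hS.preimage e.surjective) fun i x hx => ?_
    have := hst i _ hx
    rwa [FPF.congr_apply] at this
  exact Set.eq_univ_of_forall fun y => by
    simpa using h1.ge (Set.mem_univ (e.symm y))

lemma isConn_congr {D E ι : Type*} (e : D ≃ E) (τ : ι → FPF D) :
    IsConn τ ↔ IsConn fun i => FPF.congr e (τ i) := by
  refine ⟨IsConn.congr e, fun h => ?_⟩
  convert h.congr e.symm using 2 with i
  ext x
  obtain ⟨y, rfl⟩ := e.symm.surjective x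
  rw [FPF.congr_apply, Equiv.eq_symm_apply, ← FPF.congr_apply, Equiv.apply_symm_apply]

lemma card_isConn_congr {D E : Type*} (ι : Type*) (e : D ≃ E) :
    Nat.card {u : ι → FPF D // IsConn u} = Nat.card {u : ι → FPF E // IsConn u} :=
  Nat.card_congr ((Equiv.piCongrRight fun _ => FPF.congr e).subtypeEquiv (isConn_congr e))

lemma isConn_iff_closure {m : ℕ} (τ : Fin 3 → FPF (Fin m)) :
    IsConn τ ↔ ∀ x y : Fin m, ∃ g ∈ Subgroup.closure ({(τ 0).1, (τ 1).1, (τ 2).1} :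
      Set (Equiv.Perm (Fin m))), g x = y := by
  have hmem : ∀ i, (τ i).1 ∈ ({(τ 0).1, (τ 1).1, (τ 2).1} : Set (Equiv.Perm (Fin m))) := by
    intro i
    fin_cases i <;> simp
  constructor
  · intro h x y
    have := h {y | ∃ g ∈ Subgroup.closure ({(τ 0).1, (τ 1).1, (τ 2).1} :
      Set (Equiv.Perm (Fin m))), g x = y} ⟨x, 1, one_mem _, rfl⟩ (by
        rintro i _ ⟨g, hg, rfl⟩
        exact ⟨(τ i).1 * g, mul_mem (Subgroup.subset_closure (hmem i)) hg, rfl⟩)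
    exact this.ge (Set.mem_univ y)
  · rintro h S ⟨x, hx⟩ hS
    have hgen : ∀ i z, (τ i).1 z ∈ S ↔ z ∈ S :=
      fun i z => ⟨fun hz => by simpa [FPF.apply_apply] using hS i _ hz, hS i z⟩
    have key : ∀ g ∈ Subgroup.closure ({(τ 0).1, (τ 1).1, (τ 2).1} :
        Set (Equiv.Perm (Fin m))), ∀ z, g z ∈ S ↔ z ∈ S := by
      intro g hg
      induction hg using Subgroup.closure_induction with
      | mem g hg =>
        rcases hg with rfl | rfl | rfl
        exacts [hgen 0, hgen 1, hgen 2]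
      | one => simp
      | mul g k _ _ hg hk => intro z; rw [Equiv.Perm.mul_apply, hg, hk]
      | inv g _ hg =>
        intro z
        rw [← hg, ← Equiv.Perm.mul_apply, mul_inv_cancel, Equiv.Perm.one_apply]
    refine Set.eq_univ_of_forall fun y => ?_
    obtain ⟨g, hg, rfl⟩ := h x y
    exact (key g hg x).2 hx

lemma card_isConn_fin (m : ℕ) :
    Nat.card {u : Fin 3 → FPF (Fin m) // IsConn u} = cTrans m := by
  refine Nat.card_congr (Equiv.ofBijective
    (fun u => ⟨((u.1 0).1, (u.1 1).1, (u.1 2).1),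
      ⟨(u.1 0).2, (u.1 1).2, (u.1 2).2⟩, (isConn_iff_closure u.1).1 u.2⟩) ⟨?_, ?_⟩)
  · rintro ⟨u, hu⟩ ⟨v, hv⟩ h
    have h := Prod.ext_iff.1 (congrArg Subtype.val h)
    apply Subtype.ext
    funext i
    apply Subtype.ext
    fin_cases i
    exacts [h.1, congrArg Prod.fst h.2, congrArg Prod.snd h.2]
  · rintro ⟨⟨α, β, γ⟩, ⟨hα, hβ, hγ⟩, h⟩
    exact ⟨⟨![⟨α, hα⟩, ⟨β, hβ⟩, ⟨γ, hγ⟩], (isConn_iff_closure _).2 h⟩, rfl⟩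

/-- The number of triples of fixed-point-free involutions on `m` points. -/
noncomputable def triples (m : ℕ) : ℕ := Nat.card (Fin 3 → FPF (Fin m))

lemma card_triples (D : Type*) [Fintype D] :
    Nat.card (Fin 3 → FPF D) = triples (Fintype.card D) :=
  Nat.card_congr (Equiv.piCongrRight fun _ => FPF.congr (Fintype.equivFin D))

lemma card_isConn (D : Type*) [Fintype D] :
    Nat.card {u : Fin 3 → FPF D // IsConn u} = cTrans (Fintype.card D) := by
  rw [card_isConn_congr _ (Fintype.equivFin D), card_isConn_fin]

/-- Decompose a triple according to the component of a given point. -/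
lemma triples_eq_sum (m : ℕ) : triples (m + 1) =
    ∑ j ∈ Finset.range (m + 1), m.choose j * (cTrans (m + 1 - j) * triples j) := by
  classical
  have hfib : ∀ R : Finset (Fin (m + 1)),
      Nat.card {τ : Fin 3 → FPF (Fin (m + 1)) // (component τ 0)ᶜ.toFinset = R} =
        if 0 ∈ R then 0 else cTrans (m + 1 - R.card) * triples R.card := by
    intro R
    split_ifs with h0
    · refine Nat.card_eq_zero.2 (Or.inl ⟨fun τ => ?_⟩)
      have := τ.2 ▸ h0
      simp only [Set.mem_toFinset, Set.mem_compl_iff] at this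
      exact this (mem_component _ _)
    · have h1 : Fintype.card {x // x ∉ R} = m + 1 - R.card := by
        simp [Fintype.card_subtype_compl]
      have h2 : Fintype.card {x // ¬ x ∉ R} = R.card := by simp
      rw [← h1, ← card_isConn, ← congrArg triples h2, ← card_triples,
        ← card_component_eq (p := fun x => x ∉ R) _ h0]
      refine Nat.card_congr (Equiv.subtypeEquivRight fun τ => ?_)
      simp only [Finset.ext_iff, Set.ext_iff, Set.mem_toFinset, Set.mem_compl_iff,
        Set.mem_ofPred_eq]
      exact forall_congr' fun x => by tauto
  rw [triples, ← Nat.card_congr (Equiv.sigmaFiberEquiv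
    fun τ : Fin 3 → FPF (Fin (m + 1)) => (component τ 0)ᶜ.toFinset), Nat.card_sigma]
  simp_rw [hfib]
  have hset : (Finset.univ.filter fun R : Finset (Fin (m + 1)) => 0 ∉ R) =
      (Finset.univ.erase 0).powerset := by
    ext R
    simp [Finset.subset_erase]
  calc ∑ R : Finset (Fin (m + 1)),
        (if 0 ∈ R then 0 else cTrans (m + 1 - R.card) * triples R.card)
      = ∑ R ∈ (Finset.univ.erase (0 : Fin (m + 1))).powerset,
          cTrans (m + 1 - R.card) * triples R.card := by
        rw [← hset, Finset.sum_filter]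
        exact Finset.sum_congr rfl fun R _ => by split_ifs <;> rfl
    _ = _ := by
        rw [Finset.sum_powerset_apply_card fun j => cTrans (m + 1 - j) * triples j]
        simp

lemma isFPFInvolution_iff_cycleType {m : ℕ} (σ : Equiv.Perm (Fin m)) :
    IsFPFInvolution σ ↔ (∀ c ∈ σ.cycleType, c = 2) ∧ σ.cycleType.sum = m := by
  rw [← Equiv.Perm.pow_prime_eq_one_iff, IsFPFInvolution, pow_two, Equiv.Perm.sum_cycleType]
  refine and_congr_right fun _ => ?_
  have := Finset.card_eq_iff_eq_univ σ.support
  rw [Fintype.card_fin] at this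
  rw [this, Finset.eq_univ_iff_forall]
  simp

lemma isFPFInvolution_iff_replicate {n : ℕ} (σ : Equiv.Perm (Fin (2 * n))) :
    IsFPFInvolution σ ↔ σ.cycleType = Multiset.replicate n 2 := by
  rw [isFPFInvolution_iff_cycleType]
  constructor
  · rintro ⟨h, hs⟩
    rw [Multiset.eq_replicate_card.2 h] at hs ⊢
    rw [Multiset.sum_replicate, smul_eq_mul] at hs
    rw [show σ.cycleType.card = n by omega]
  · intro h
    rw [h]
    refine ⟨fun c => Multiset.eq_of_mem_replicate, ?_⟩
    simp [mul_comm]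

lemma card_FPF_even (n : ℕ) :
    Nat.card (FPF (Fin (2 * n))) = (2 * n).factorial / (2 ^ n * n.factorial) := by
  classical
  have h := Equiv.Perm.card_of_cycleType (Fin (2 * n)) (Multiset.replicate n 2)
  rw [if_pos ⟨by simp [mul_comm], fun c hc => (Multiset.eq_of_mem_replicate hc).ge⟩] at h
  rw [Nat.card_eq_fintype_card, Fintype.card_subtype]
  simp_rw [isFPFInvolution_iff_replicate]
  rw [h]
  have hprod : ∏ c ∈ (Multiset.replicate n 2).toFinset,
      ((Multiset.replicate n 2).count c).factorial = n.factorial := by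
    rcases Nat.eq_zero_or_pos n with rfl | hn
    · simp
    · rw [Multiset.toFinset_replicate, if_neg hn.ne']
      simp
  rw [hprod]
  simp [mul_comm 2 n]

lemma isEmpty_FPF_odd (n : ℕ) : IsEmpty (FPF (Fin (2 * n + 1))) := by
  refine ⟨fun σ => ?_⟩
  obtain ⟨h, hs⟩ := (isFPFInvolution_iff_cycleType _).1 σ.2
  rw [Multiset.eq_replicate_card.2 h, Multiset.sum_replicate, smul_eq_mul] at hs
  omega

lemma triples_odd (n : ℕ) : triples (2 * n + 1) = 0 := by
  have := isEmpty_FPF_odd n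
  exact Nat.card_eq_zero.2 (Or.inl ⟨fun τ => isEmptyElim (τ 0)⟩)

lemma two_pow_mul_factorial_dvd (n : ℕ) : 2 ^ n * n.factorial ∣ (2 * n).factorial := by
  rw [← Nat.doubleFactorial_two_mul]
  cases n with
  | zero => simp
  | succ n => exact ⟨_, Nat.factorial_eq_mul_doubleFactorial (2 * n + 1)⟩

/-- The coefficients of the exponential generating function of `triples`, in even degrees. -/
noncomputable def tripleCoeff (n : ℕ) : ℚ := triples (2 * n) / (2 * n).factorial

lemma tripleCoeff_eq (n : ℕ) :
    tripleCoeff n = ((2 * n).factorial : ℚ) ^ 2 / (2 ^ n * n.factorial) ^ 3 := by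
  have h0 : ((2 * n).factorial : ℚ) ≠ 0 := by exact_mod_cast (2 * n).factorial_ne_zero
  have h1 : (n.factorial : ℚ) ≠ 0 := by exact_mod_cast n.factorial_ne_zero
  rw [tripleCoeff, triples, Nat.card_fun, card_FPF_even, Nat.card_eq_fintype_card,
    Fintype.card_fin, Nat.cast_pow, Nat.cast_div (two_pow_mul_factorial_dvd n) (by simp [h1])]
  push_cast
  field_simp

lemma tripleCoeff_zero : tripleCoeff 0 = 1 := by
  simp [tripleCoeff_eq]

lemma tripleCoeff_succ (n : ℕ) :
    2 * (n + 1) * tripleCoeff (n + 1) = (2 * n + 1) ^ 2 * tripleCoeff n := by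
  have h1 : (n.factorial : ℚ) ≠ 0 := by exact_mod_cast n.factorial_ne_zero
  have h2 : (n : ℚ) + 1 ≠ 0 := by positivity
  rw [tripleCoeff_eq, tripleCoeff_eq, show 2 * (n + 1) = 2 * n + 1 + 1 by ring]
  simp only [Nat.factorial_succ]
  push_cast
  field_simp
  ring

lemma sum_range_two_mul_of_odd_eq_zero {M : Type*} [AddCommMonoid M] (f : ℕ → M)
    (hf : ∀ i, f (2 * i + 1) = 0) (n : ℕ) :
    ∑ j ∈ Finset.range (2 * n), f j = ∑ i ∈ Finset.range n, f (2 * i) := by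
  induction n with
  | zero => simp
  | succ n ih =>
    rw [show 2 * (n + 1) = 2 * n + 1 + 1 by ring, Finset.sum_range_succ, Finset.sum_range_succ,
      hf, add_zero, ih, Finset.sum_range_succ]

lemma tripleCoeff_eq_sum (n : ℕ) :
    2 * (n + 1 : ℚ) * tripleCoeff (n + 1) =
      ∑ i ∈ Finset.range (n + 1), a (n + 1 - i) * tripleCoeff i := by
  have h := triples_eq_sum (2 * n + 1)
  rw [show 2 * n + 1 + 1 = 2 * (n + 1) by ring,
    sum_range_two_mul_of_odd_eq_zero _ (by simp [triples_odd])] at h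
  rw [tripleCoeff, h, show 2 * (n + 1) = 2 * n + 1 + 1 by ring, Nat.factorial_succ]
  push_cast
  rw [mul_div_assoc', mul_comm, show (2 * (n + 1 : ℚ)) = 2 * n + 1 + 1 by ring,
    mul_comm (2 * (n : ℚ) + 1 + 1) (((2 * n + 1).factorial : ℕ) : ℚ),
    mul_div_mul_right _ _ (by positivity), Finset.sum_div]
  refine Finset.sum_congr rfl fun i hi => ?_
  have hi' : i ≤ n := Nat.lt_succ_iff.1 (Finset.mem_range.1 hi)
  obtain ⟨k, rfl⟩ := Nat.exists_eq_add_of_le hi'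
  have e1 : 2 * (i + k) + 1 + 1 - 2 * i = 2 * (k + 1) := by omega
  have e2 : i + k + 1 - i = k + 1 := by omega
  have e3 : 2 * (i + k) + 1 - 2 * i = 2 * (k + 1) - 1 := by omega
  rw [e1, e2, a, tripleCoeff, Nat.cast_choose ℚ (by omega : 2 * i ≤ 2 * (i + k) + 1), e3]
  have h0 : ((2 * (i + k) + 1).factorial : ℚ) ≠ 0 := by
    exact_mod_cast Nat.factorial_ne_zero _
  field_simp

open PowerSeries in
lemma coeff_X_mul_derivative (f : ℚ⟦X⟧) (n : ℕ) :
    coeff n (X * derivative ℚ f) = n * coeff n f := by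
  cases n with
  | zero => simp
  | succ n =>
    rw [coeff_succ_X_mul, coeff_derivative]
    push_cast
    ring

open PowerSeries in
lemma coeff_two_mul (f : ℚ⟦X⟧) (n : ℕ) : coeff n (2 * f) = 2 * coeff n f := by
  rw [two_mul, map_add, two_mul]

open PowerSeries in
lemma a_succ_eq (n : ℕ) (hn : 1 ≤ n) :
    a (n + 1) = 2 * (n + 1) * a n + ∑ k ∈ Finset.Icc 1 (n - 1), a k * a (n - k) := by
  let T : ℚ⟦X⟧ := mk tripleCoeff
  let A : ℚ⟦X⟧ := mk fun n => if n = 0 then 0 else a n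
  let d := derivative ℚ
  have h1 : 2 * (X * d T) = A * T := by
    ext n
    rw [coeff_two_mul, coeff_X_mul_derivative, mul_comm A, coeff_mul,
      Finset.Nat.sum_antidiagonal_eq_sum_range_succ fun i j => coeff i T * coeff j A]
    simp only [T, A, coeff_mk]
    rw [Finset.sum_range_succ, Nat.sub_self, if_pos rfl, mul_zero, add_zero]
    cases n with
    | zero => simp
    | succ n =>
      push_cast
      rw [← mul_assoc, tripleCoeff_eq_sum]
      refine Finset.sum_congr rfl fun i hi => ?_
      rw [if_neg (Nat.sub_ne_zero_of_lt (Finset.mem_range.1 hi)), mul_comm]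
  have h2 : 2 * d T = 2 * (2 * (X * d (X * d T))) + 2 * (2 * (X * d T)) + T := by
    ext n
    simp only [map_add, coeff_two_mul, coeff_X_mul_derivative, d, coeff_derivative]
    simp only [T, coeff_mk]
    linear_combination tripleCoeff_succ n
  have h3 : 2 * (X * d (X * d T)) = A * (X * d T) + T * (X * d A) := by
    have h4 : d (2 * (X * d T)) = d (A * T) := congrArg d h1
    rw [two_mul, map_add, Derivation.leibniz _ A, smul_eq_mul, smul_eq_mul] at h4
    linear_combination X * h4
  have h5 : A * T = X * (2 * (X * d A) + A * A + 2 * A + 1) * T := by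
    linear_combination (X * A + 2 * X - 1) * h1 + X * h2 + 2 * X * h3
  have hT : T ≠ 0 := fun h => by
    have := congrArg (coeff 0) h
    simp [T, tripleCoeff_zero] at this
  have h6 := congrArg (coeff (n + 1)) (mul_right_cancel₀ hT h5)
  rw [coeff_succ_X_mul] at h6
  simp only [map_add, coeff_two_mul, coeff_X_mul_derivative, d, coeff_mul n A A, coeff_one] at h6
  rw [Finset.Nat.sum_antidiagonal_eq_sum_range_succ fun i j => coeff i A * coeff j A] at h6
  simp only [A, coeff_mk, if_neg (by omega : n ≠ 0), if_neg n.succ_ne_zero] at h6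
  have h7 : ∑ k ∈ Finset.Icc 1 (n - 1), a k * a (n - k) = ∑ k ∈ Finset.range n.succ,
      (if k = 0 then 0 else a k) * (if n - k = 0 then 0 else a (n - k)) := by
    have hsub : Finset.Icc 1 (n - 1) ⊆ Finset.range n.succ := fun k hk => by
      rw [Finset.mem_Icc] at hk
      rw [Finset.mem_range]
      omega
    rw [← Finset.sum_subset hsub]
    · refine Finset.sum_congr rfl fun k hk => ?_
      rw [Finset.mem_Icc] at hk
      rw [if_neg (by omega), if_neg (by omega)]
    · intro k hk hk'
      rw [Finset.mem_range] at hk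
      rw [Finset.mem_Icc] at hk'
      by_cases hk0 : k = 0
      · simp [hk0]
      · rw [if_pos (by omega : n - k = 0), mul_zero]
  rw [h7]
  linear_combination h6

lemma a_one : a 1 = 1 := by
  have h := tripleCoeff_eq_sum 0
  have h1 := tripleCoeff_succ 0
  simp [tripleCoeff_zero] at h h1
  linarith

theorem rooted_pavings_recurrence :
    a 1 = 1 ∧
    ∀ n : ℕ, 2 ≤ n →
      a n = 2 * n * a (n - 1) +
        ∑ k ∈ Finset.Icc 1 (n - 2), a k * a (n - 1 - k) := by
  refine ⟨a_one, fun n hn => ?_⟩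
  obtain ⟨m, rfl⟩ := Nat.exists_eq_add_of_le' (by omega : 1 ≤ n)
  have h := a_succ_eq m (by omega)
  simpa [Nat.sub_sub] using h
end

section
/- Let pav_r(2k) = c(2k)/(2k−1)!, where c(m) is the number of transitive triples of fixed-point-free involutions on Fin m. Then pav_r(2k) is asymptotically equivalent to 2·√(2/π)·(2/e)^k·k^{k+1/2}; that is, the ratio pav_r(2k) / (2·√(2/π)·(2/e)^k·k^{k+1/2}) tends to 1 as k → ∞. -/
open Filter

/-- `pav_r(m) = c(m)/(m-1)!`, the number of rooted connected pavings on `m`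
darts, as a real number. -/
noncomputable def pavr (m : ℕ) : ℝ :=
  (cTrans m : ℝ) / (Nat.factorial (m - 1) : ℝ)

section Pavings

open scoped Nat

open Equiv Finset

section Counting

theorem IsFPFInvolution.subtypePerm {α : Type*} {σ : Perm α} (h : IsFPFInvolution σ) {p : α → Prop}
    (hp : ∀ x, p (σ x) ↔ p x) : IsFPFInvolution (σ.subtypePerm hp) := by
  refine ⟨?_, fun x hx => h.2 x (congrArg Subtype.val hx)⟩
  ext x
  exact congrArg (fun τ : Perm α => τ x) h.1

theorem natCard_isFPFInvolution_preserving_le {α : Type*} [Finite α] (p : α → Prop) :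
    Nat.card {σ : Perm α // IsFPFInvolution σ ∧ ∀ x, p (σ x) ↔ p x} ≤
      Nat.card {σ : Perm {x // p x} // IsFPFInvolution σ} *
        Nat.card {σ : Perm {x // ¬ p x} // IsFPFInvolution σ} := by
  rw [← Nat.card_prod]
  refine Nat.card_le_card_of_injective
    (fun σ => (⟨σ.1.subtypePerm σ.2.2, σ.2.1.subtypePerm _⟩,
      ⟨σ.1.subtypePerm fun x => not_congr (σ.2.2 x), σ.2.1.subtypePerm _⟩)) ?_
  rintro ⟨σ, hσ⟩ ⟨τ, hτ⟩ h
  simp only [Prod.mk.injEq, Subtype.mk.injEq] at h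
  ext x
  by_cases hx : p x
  · exact congrArg Subtype.val (congrArg (fun ρ : Perm {x // p x} => ρ ⟨x, hx⟩) h.1)
  · exact congrArg Subtype.val (congrArg (fun ρ : Perm {x // ¬ p x} => ρ ⟨x, hx⟩) h.2)

variable {α : Type*} [Fintype α] [DecidableEq α]

theorem IsFPFInvolution.support_eq_univ {σ : Perm α} (h : IsFPFInvolution σ) :
    σ.support = univ := by
  ext x
  simpa using h.2 x

theorem IsFPFInvolution.two_dvd_card {σ : Perm α} (h : IsFPFInvolution σ) :
    2 ∣ Fintype.card α := by
  have := Perm.two_dvd_card_support (σ := σ) (by rw [pow_two]; exact h.1)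
  rwa [h.support_eq_univ, card_univ] at this

theorem isFPFInvolution_iff_cycleType_s9 {k : ℕ} (hα : Fintype.card α = 2 * k) (σ : Perm α) :
    IsFPFInvolution σ ↔ σ.cycleType = Multiset.replicate k 2 := by
  constructor
  · intro h
    have h2 := Perm.cycleType_of_pow_prime_eq_one (σ := σ) (p := 2) (by rw [pow_two]; exact h.1)
    have hs := σ.sum_cycleType
    rw [h.support_eq_univ, card_univ, hα, h2, Multiset.sum_replicate, smul_eq_mul] at hs
    rw [h2]
    congr 1
    omega
  · intro h
    refine ⟨?_, fun x => ?_⟩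
    · rw [← pow_two, Perm.pow_prime_eq_one_iff, h]
      exact fun c hc => Multiset.eq_of_mem_replicate hc
    · have hs := σ.sum_cycleType
      rw [h, Multiset.sum_replicate, smul_eq_mul, mul_comm, ← hα] at hs
      rw [← Perm.mem_support, (card_eq_iff_eq_univ _).1 hs.symm]
      exact mem_univ x

theorem natCard_isFPFInvolution_mul {k : ℕ} (hα : Fintype.card α = 2 * k) :
    Nat.card {σ : Perm α // IsFPFInvolution σ} * (2 ^ k * k !) = (2 * k)! := by
  classical
  have h := Perm.card_of_cycleType_mul_eq α (Multiset.replicate k 2)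
  rw [if_pos, hα] at h
  · have hp : ∏ n ∈ (Multiset.replicate k 2).toFinset, ((Multiset.replicate k 2).count n)! = k ! := by
      rcases Nat.eq_zero_or_pos k with rfl | hk
      · simp
      · simp [Multiset.toFinset_replicate, hk.ne']
    rw [hp, Multiset.sum_replicate, Multiset.prod_replicate, smul_eq_mul, mul_comm k 2,
      Nat.sub_self, Nat.factorial_zero, one_mul] at h
    rw [← h]
    congr 1
    rw [Nat.card_eq_fintype_card, Fintype.card_subtype]
    congr 1
    ext σ
    simp [isFPFInvolution_iff_cycleType_s9 hα]
  · refine ⟨?_, fun a ha => (Multiset.eq_of_mem_replicate ha).ge⟩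
    simp [hα, mul_comm]

/-- The number of fixed-point-free involutions of a set with `2 * k` elements. -/
noncomputable def fpfCount (k : ℕ) : ℝ := ((2 * k)! : ℝ) / (2 ^ k * (k ! : ℝ))

theorem fpfCount_pos (k : ℕ) : 0 < fpfCount k := by
  unfold fpfCount
  positivity

theorem natCard_isFPFInvolution {k : ℕ} (hα : Fintype.card α = 2 * k) :
    (Nat.card {σ : Perm α // IsFPFInvolution σ} : ℝ) = fpfCount k := by
  rw [fpfCount, eq_div_iff (by positivity)]
  exact_mod_cast natCard_isFPFInvolution_mul hα

open Classical in
/-- The fixed-point-free involutions that preserve a given subset. -/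
noncomputable def fpfPreserving (S : Finset α) : Finset (Perm α) :=
  {σ | IsFPFInvolution σ ∧ ∀ x, σ x ∈ S ↔ x ∈ S}

theorem card_fpfPreserving_le {k j : ℕ} (hα : Fintype.card α = 2 * k)
    {S : Finset α} (hS : #S = 2 * j) :
    (#(fpfPreserving S) : ℝ) ≤ fpfCount j * fpfCount (k - j) := by
  classical
  have h1 : Fintype.card {x // x ∈ S} = 2 * j := by simpa using hS
  have h2 : Fintype.card {x // x ∉ S} = 2 * (k - j) := by
    rw [Fintype.card_subtype_compl, h1, hα, Nat.mul_sub]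
  rw [← natCard_isFPFInvolution h1, ← natCard_isFPFInvolution h2]
  have h3 := natCard_isFPFInvolution_preserving_le (fun x => x ∈ S)
  rw [Nat.card_eq_fintype_card, Fintype.card_subtype] at h3
  rw [fpfPreserving]
  exact_mod_cast h3

theorem two_dvd_card_of_mem_fpfPreserving {S : Finset α} {σ : Perm α}
    (h : σ ∈ fpfPreserving S) : 2 ∣ #S := by
  classical
  rw [fpfPreserving, mem_filter] at h
  have := (h.2.1.subtypePerm h.2.2).two_dvd_card
  simpa using this

end Counting

section Triples

open Classical in
/-- The triples of fixed-point-free involutions of `Fin m`. -/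
noncomputable def fpfTriples (m : ℕ) : Finset (Perm (Fin m) × Perm (Fin m) × Perm (Fin m)) :=
  {t | IsFPFInvolution t.1 ∧ IsFPFInvolution t.2.1 ∧ IsFPFInvolution t.2.2}

theorem card_fpfTriples (k : ℕ) : (#(fpfTriples (2 * k)) : ℝ) = fpfCount k ^ 3 := by
  classical
  have h : fpfTriples (2 * k) =
      ({σ | IsFPFInvolution σ} : Finset (Perm (Fin (2 * k)))) ×ˢ
        (({σ | IsFPFInvolution σ} : Finset (Perm (Fin (2 * k)))) ×ˢ
          ({σ | IsFPFInvolution σ} : Finset (Perm (Fin (2 * k))))) := by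
    ext t
    simp [fpfTriples]
  rw [h, card_product, card_product,
    ← natCard_isFPFInvolution (Fintype.card_fin (2 * k)),
    Nat.card_eq_fintype_card, Fintype.card_subtype]
  push_cast
  ring

theorem cTrans_le (k : ℕ) : (cTrans (2 * k) : ℝ) ≤ fpfCount k ^ 3 := by
  classical
  rw [← card_fpfTriples, cTrans, Nat.card_eq_fintype_card, Fintype.card_subtype]
  refine Nat.cast_le.2 (card_le_card fun t ht => ?_)
  simp only [fpfTriples, mem_filter, mem_univ, true_and] at ht ⊢
  exact ht.1

theorem exists_preserved_of_not_transitive {m : ℕ}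
    {t : Perm (Fin m) × Perm (Fin m) × Perm (Fin m)} (ht : t ∈ fpfTriples m)
    (h : ¬ IsTransitiveTriple t) :
    ∃ S : Finset (Fin m), 0 < #S ∧ #S < m ∧
      t ∈ fpfPreserving S ×ˢ (fpfPreserving S ×ˢ fpfPreserving S) := by
  classical
  simp only [fpfTriples, mem_filter, mem_univ, true_and] at ht
  rw [IsTransitiveTriple, not_and] at h
  have h' := h ht
  push Not at h'
  obtain ⟨x, y, hxy⟩ := h'
  set G := Subgroup.closure ({t.1, t.2.1, t.2.2} : Set (Perm (Fin m))) with hG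
  let S : Finset (Fin m) := {z | ∃ g ∈ G, g x = z}
  have hS : ∀ z, z ∈ S ↔ ∃ g ∈ G, g x = z := fun z => by simp [S]
  have hpres : ∀ σ ∈ G, ∀ z, σ z ∈ S ↔ z ∈ S := by
    intro σ hσ z
    rw [hS, hS]
    constructor
    · rintro ⟨g, hg, hgz⟩
      exact ⟨σ⁻¹ * g, G.mul_mem (G.inv_mem hσ) hg, by simp [hgz]⟩
    · rintro ⟨g, hg, rfl⟩
      exact ⟨σ * g, G.mul_mem hσ hg, rfl⟩
  refine ⟨S, card_pos.2 ⟨x, (hS x).2 ⟨1, G.one_mem, rfl⟩⟩, ?_, ?_⟩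
  · have hy : y ∉ S := fun hy => by
      obtain ⟨g, hg, hgy⟩ := (hS y).1 hy
      exact hxy g hg hgy
    simpa using card_lt_univ_of_notMem hy
  · have hsub : ({t.1, t.2.1, t.2.2} : Set (Perm (Fin m))) ⊆ G := Subgroup.subset_closure
    simp only [mem_product, fpfPreserving, mem_filter, mem_univ, true_and]
    exact ⟨⟨ht.1, hpres _ (hsub (by simp))⟩, ⟨ht.2.1, hpres _ (hsub (by simp))⟩,
      ⟨ht.2.2, hpres _ (hsub (by simp))⟩⟩

theorem fpfCount_pow_three_sub_le_cTrans (k : ℕ) :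
    fpfCount k ^ 3 - ∑ j ∈ Ioo 0 k, ((2 * k).choose (2 * j) : ℝ) *
      (fpfCount j * fpfCount (k - j)) ^ 3 ≤ cTrans (2 * k) := by
  classical
  let T : Finset (Perm (Fin (2 * k)) × Perm (Fin (2 * k)) × Perm (Fin (2 * k))) :=
    {t | IsTransitiveTriple t}
  let B : ℕ → Finset (Perm (Fin (2 * k)) × Perm (Fin (2 * k)) × Perm (Fin (2 * k))) := fun j =>
    (powersetCard (2 * j) univ).biUnion fun S =>
      fpfPreserving S ×ˢ (fpfPreserving S ×ˢ fpfPreserving S)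
  have hcover : fpfTriples (2 * k) ⊆ T ∪ (Ioo 0 k).biUnion B := by
    intro t ht
    by_cases h : IsTransitiveTriple t
    · exact mem_union_left _ (by simpa [T] using h)
    · obtain ⟨S, hS0, hSm, htS⟩ := exists_preserved_of_not_transitive ht h
      obtain ⟨j, hj⟩ := two_dvd_card_of_mem_fpfPreserving (mem_product.1 htS).1
      refine mem_union_right _ (mem_biUnion.2 ⟨j, mem_Ioo.2 ⟨by omega, by omega⟩, ?_⟩)
      exact mem_biUnion.2 ⟨S, mem_powersetCard.2 ⟨subset_univ _, hj⟩, htS⟩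
  have hB : ∀ j ∈ Ioo 0 k, (#(B j) : ℝ) ≤ ((2 * k).choose (2 * j) : ℝ) *
      (fpfCount j * fpfCount (k - j)) ^ 3 := by
    intro j _
    have h1 : (#(B j) : ℝ) ≤ ∑ S ∈ powersetCard (2 * j) (univ : Finset (Fin (2 * k))),
        (#(fpfPreserving S ×ˢ (fpfPreserving S ×ˢ fpfPreserving S)) : ℝ) := by
      exact_mod_cast card_biUnion_le
    refine h1.trans ?_
    have h2 := sum_le_card_nsmul (powersetCard (2 * j) (univ : Finset (Fin (2 * k))))
      (fun S => (#(fpfPreserving S ×ˢ (fpfPreserving S ×ˢ fpfPreserving S)) : ℝ))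
      ((fpfCount j * fpfCount (k - j)) ^ 3) (fun S hS => by
        have h3 := card_fpfPreserving_le (Fintype.card_fin (2 * k))
          (mem_powersetCard.1 hS).2
        rw [card_product, card_product]
        push_cast
        calc (#(fpfPreserving S) : ℝ) * (#(fpfPreserving S) * #(fpfPreserving S))
            = (#(fpfPreserving S) : ℝ) ^ 3 := by ring
          _ ≤ _ := by gcongr)
    simpa [card_powersetCard] using h2
  have h1 := (card_le_card hcover).trans (card_union_le _ _)
  have h2 : (#(fpfTriples (2 * k)) : ℝ) ≤ #T + ∑ j ∈ Ioo 0 k, (#(B j) : ℝ) := by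
    exact_mod_cast h1.trans (Nat.add_le_add_left card_biUnion_le _)
  have h3 : (cTrans (2 * k) : ℝ) = #T := by
    rw [cTrans, Nat.card_eq_fintype_card, Fintype.card_subtype]
  rw [card_fpfTriples] at h2
  have := sum_le_sum hB
  linarith

end Triples

section Estimates

theorem choose_sq_le_choose_two_mul {k j : ℕ} : k.choose j ^ 2 ≤ (2 * k).choose (2 * j) := by
  rw [two_mul k, Nat.add_choose_eq, pow_two]
  exact single_le_sum (f := fun ij : ℕ × ℕ => k.choose ij.1 * k.choose ij.2)
    (fun _ _ => Nat.zero_le _) (a := (j, j)) (by simp [two_mul])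

theorem choose_mul_fpfCount_mul {k j : ℕ} (hj : j ≤ k) :
    ((2 * k).choose (2 * j) : ℝ) * (fpfCount j * fpfCount (k - j)) =
      fpfCount k * k.choose j := by
  obtain ⟨i, rfl⟩ := Nat.exists_eq_add_of_le hj
  rw [Nat.add_sub_cancel_left, mul_add, Nat.cast_add_choose, Nat.cast_add_choose]
  unfold fpfCount
  rw [mul_add, pow_add]
  field_simp

theorem choose_mul_fpfCount_pow_three_le {k j : ℕ} (hj : j ≤ k) :
    ((2 * k).choose (2 * j) : ℝ) * (fpfCount j * fpfCount (k - j)) ^ 3 ≤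
      fpfCount k ^ 3 * (k.choose j : ℝ)⁻¹ := by
  have hA : (0 : ℝ) < (2 * k).choose (2 * j) := by
    exact_mod_cast Nat.choose_pos (by omega)
  have hB : (0 : ℝ) < k.choose j := by exact_mod_cast Nat.choose_pos hj
  have hAB : (k.choose j : ℝ) ^ 2 ≤ (2 * k).choose (2 * j) := by
    exact_mod_cast choose_sq_le_choose_two_mul
  have hD := fpfCount_pos k
  have hp : fpfCount j * fpfCount (k - j) =
      fpfCount k * k.choose j / (2 * k).choose (2 * j) := by
    rw [eq_div_iff hA.ne', mul_comm, choose_mul_fpfCount_mul hj]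
  rw [hp]
  generalize ((2 * k).choose (2 * j) : ℝ) = A at *
  generalize (k.choose j : ℝ) = B at *
  rw [← div_eq_mul_inv, le_div_iff₀ hB]
  calc A * (fpfCount k * B / A) ^ 3 * B = fpfCount k ^ 3 * ((B ^ 2) ^ 2 / A ^ 2) := by
        field_simp
    _ ≤ fpfCount k ^ 3 * 1 := by
        gcongr
        exact div_le_one_of_le₀ (by gcongr) (by positivity)
    _ = _ := mul_one _

theorem le_choose_of_pos_of_lt {k j : ℕ} (h0 : 0 < j) (hj : j < k) : k ≤ k.choose j := by
  induction k generalizing j with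
  | zero => omega
  | succ k ih =>
    obtain ⟨i, rfl⟩ := Nat.exists_eq_succ_of_ne_zero h0.ne'
    rw [Nat.choose_succ_succ]
    have hp : 0 < k.choose i := Nat.choose_pos (by omega)
    rcases Nat.lt_or_ge i.succ k with h | h
    · have := ih h0 h
      omega
    · obtain rfl : k = i.succ := by omega
      simp

theorem choose_two_le_choose {k j : ℕ} (h0 : 2 ≤ j) (hj : j + 2 ≤ k) :
    k.choose 2 ≤ k.choose j := by
  induction k generalizing j with
  | zero => omega
  | succ k ih =>
    obtain ⟨i, rfl⟩ := Nat.exists_eq_succ_of_ne_zero (show j ≠ 0 by omega)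
    rw [Nat.choose_succ_succ, Nat.choose_succ_succ k i, Nat.choose_one_right]
    rcases Nat.lt_or_ge k (i.succ + 2) with h | h
    · obtain rfl : k = i + 2 := by omega
      have h1 := le_choose_of_pos_of_lt (k := i + 2) (j := i.succ) (by omega) (by omega)
      have h2 : (i + 2).choose i = (i + 2).choose 2 := Nat.choose_symm_add
      have h3 : (i + 2).choose (i + 1) = i + 2 := Nat.choose_succ_self_right (i + 1)
      simp only [Nat.succ_eq_add_one, Nat.reduceAdd] at *
      omega
    · have h1 := le_choose_of_pos_of_lt (k := k) (j := i) (by omega) (by omega)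
      exact Nat.add_le_add h1 (ih h0 h)

theorem inv_choose_le {k j : ℕ} (hj : j ∈ Ioo 0 k) :
    (k.choose j : ℝ)⁻¹ ≤ (if j = 1 then (k : ℝ)⁻¹ else 0) +
      (if j = k - 1 then (k : ℝ)⁻¹ else 0) + (k.choose 2 : ℝ)⁻¹ := by
  obtain ⟨h0, hk⟩ := mem_Ioo.1 hj
  have hk0 : (0 : ℝ) < k := by exact_mod_cast h0.trans hk
  have h1 : (k.choose j : ℝ)⁻¹ ≤ (k : ℝ)⁻¹ :=
    inv_anti₀ hk0 (by exact_mod_cast le_choose_of_pos_of_lt h0 hk)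
  have h2 : (0 : ℝ) ≤ (k.choose 2 : ℝ)⁻¹ := by positivity
  have h3 : (0 : ℝ) ≤ (k : ℝ)⁻¹ := by positivity
  by_cases hj1 : j = 1
  · rw [if_pos hj1]
    split_ifs
    all_goals linarith
  by_cases hj2 : j = k - 1
  · rw [if_pos hj2]
    split_ifs
    linarith
  rw [if_neg hj1, if_neg hj2, add_zero, zero_add]
  refine inv_anti₀ ?_ ?_
  · exact_mod_cast Nat.choose_pos (by omega)
  · exact_mod_cast choose_two_le_choose (by omega) (by omega)

theorem sum_inv_choose_le (k : ℕ) : ∑ j ∈ Ioo 0 k, (k.choose j : ℝ)⁻¹ ≤ 4 / k := by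
  rcases Nat.lt_or_ge k 2 with hk | hk
  · rw [sum_eq_zero]
    · positivity
    · intro j hj
      have := mem_Ioo.1 hj
      omega
  have hk' : (2 : ℝ) ≤ k := by exact_mod_cast hk
  refine (sum_le_sum fun j hj => inv_choose_le hj).trans ?_
  rw [sum_add_distrib, sum_add_distrib, sum_ite_eq', sum_ite_eq', sum_const, Nat.card_Ioo,
    if_pos (mem_Ioo.2 ⟨by omega, by omega⟩), if_pos (mem_Ioo.2 ⟨by omega, by omega⟩),
    Nat.cast_choose_two, nsmul_eq_mul, Nat.sub_zero, Nat.cast_sub (by omega), Nat.cast_one]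
  have : (k : ℝ) - 1 ≠ 0 := by linarith
  apply le_of_eq
  field_simp
  ring

theorem tendsto_cTrans_div_fpfCount_pow_three :
    Tendsto (fun k : ℕ => (cTrans (2 * k) : ℝ) / fpfCount k ^ 3) atTop (nhds 1) := by
  have hlim : Tendsto (fun k : ℕ => 1 - 4 / (k : ℝ)) atTop (nhds 1) := by
    simpa using (tendsto_const_div_atTop_nhds_zero_nat (4 : ℝ)).const_sub 1
  refine tendsto_of_tendsto_of_tendsto_of_le_of_le hlim tendsto_const_nhds (fun k => ?_)
    (fun k => ?_)
  · have hD : 0 < fpfCount k ^ 3 := pow_pos (fpfCount_pos k) 3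
    change 1 - 4 / (k : ℝ) ≤ (cTrans (2 * k) : ℝ) / fpfCount k ^ 3
    rw [le_div_iff₀ hD]
    have h1 := fpfCount_pow_three_sub_le_cTrans k
    have h2 := sum_le_sum fun j (hj : j ∈ Ioo 0 k) =>
      choose_mul_fpfCount_pow_three_le (mem_Ioo.1 hj).2.le
    rw [← mul_sum] at h2
    have h3 := mul_le_mul_of_nonneg_left (sum_inv_choose_le k) hD.le
    linarith
  · exact div_le_one_of_le₀ (cTrans_le k) (pow_nonneg (fpfCount_pos k).le 3)

theorem fpfCount_pow_three_div_eq {k : ℕ} (hk : 0 < k) :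
    fpfCount k ^ 3 / ((2 * k - 1)! : ℝ) /
        (2 * Real.sqrt (2 / Real.pi) * (2 / Real.exp 1) ^ k * (k : ℝ) ^ ((k : ℝ) + 1 / 2)) =
      Real.sqrt Real.pi * Stirling.stirlingSeq (2 * k) ^ 2 / Stirling.stirlingSeq k ^ 3 := by
  have hk' : (0 : ℝ) < k := by exact_mod_cast hk
  have hpred : ((2 * k)! : ℝ) = 2 * k * ((2 * k - 1)! : ℝ) := by
    exact_mod_cast (Nat.mul_factorial_pred (by omega : 2 * k ≠ 0)).symm
  have hpow : (k : ℝ) ^ ((k : ℝ) + 1 / 2) = (k : ℝ) ^ k * Real.sqrt k := by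
    rw [Real.rpow_add hk', Real.rpow_natCast, Real.sqrt_eq_rpow]
  have h4 : Real.sqrt (2 * ((2 * k : ℕ) : ℝ)) = 2 * Real.sqrt k := by
    rw [show (2 * ((2 * k : ℕ) : ℝ)) = 2 ^ 2 * k by push_cast; ring,
      Real.sqrt_mul (by positivity), Real.sqrt_sq (by positivity)]
  have hpi := Real.pi_pos
  have hs2 : Real.sqrt 2 ^ 2 = 2 := Real.sq_sqrt (by positivity)
  have hsk : Real.sqrt k ^ 2 = k := Real.sq_sqrt (by positivity)
  rw [hpow, Stirling.stirlingSeq, Stirling.stirlingSeq, h4, Real.sqrt_mul (by positivity),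
    Real.sqrt_div (by positivity), fpfCount, hpred]
  have hs2' : 0 < Real.sqrt 2 := by positivity
  have hsk' : 0 < Real.sqrt k := by positivity
  have hsp' : 0 < Real.sqrt Real.pi := by positivity
  have he : 0 < Real.exp 1 := Real.exp_pos 1
  have hf : (0 : ℝ) < (2 * k - 1)! := by positivity
  have hg : (0 : ℝ) < k ! := by positivity
  push_cast
  rw [pow_mul _ 2 k]
  simp only [div_pow, mul_pow]
  generalize Real.sqrt 2 = a at *
  generalize Real.sqrt k = b at *
  rw [← hsk, ← hs2]
  field_simp
  ring

end Estimates

end Pavings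

theorem rooted_pavings_asymptotics :
    Tendsto (fun k : ℕ =>
      pavr (2 * k) /
        (2 * Real.sqrt (2 / Real.pi) * (2 / Real.exp 1) ^ k *
          (k : ℝ) ^ ((k : ℝ) + 1 / 2)))
      atTop (nhds 1) := by
  have hk2 : Tendsto (fun k : ℕ => 2 * k) atTop atTop :=
    tendsto_id.const_mul_atTop' (by norm_num)
  have hpi : 0 < Real.sqrt Real.pi := Real.sqrt_pos.2 Real.pi_pos
  have hst := Stirling.tendsto_stirlingSeq_sqrt_pi
  have h1 := (((hst.comp hk2).pow 2).const_mul (Real.sqrt Real.pi)).div (hst.pow 3)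
    (pow_pos hpi 3).ne'
  have h2 := tendsto_cTrans_div_fpfCount_pow_three.mul h1
  rw [show 1 * (Real.sqrt Real.pi * Real.sqrt Real.pi ^ 2 / Real.sqrt Real.pi ^ 3) = 1 by
    field_simp] at h2
  refine h2.congr' ?_
  filter_upwards [eventually_gt_atTop 0] with k hk
  have h3 := fpfCount_pow_three_div_eq hk
  have hD := fpfCount_pos k
  simp only [Pi.div_apply, Function.comp_apply] at *
  rw [← h3, pavr]
  field_simp
end
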